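/- Assume parts (2), (3) and (4) of Hypothesis (H), i.e., there exist K ⊂ ℕ*, x_0 ∈ K and positive constants c_2, c_3, c_4, λ_0 with: for all t ≥ 0, inf_{x∈K} ℙ_x(t < T_0) ≥ c_2 · sup_{x∈K} ℙ_x(t < T_0); for all t ≥ 0, ℙ_{x_0}(X_t ∈ K) ≥ c_3 e^{−λ_0 t}; and sup_{x∈ℕ*} 𝔼_x(e^{λ_0 (T_K ∧ T_0)}) ≤ c_4. Then for all t ≥ 0, ℙ_{x_0}(t < T_0) ≥ (c_2 c_3 / (2 c_4)) · sup_{x∈ℕ*} ℙ_x(t < T_0). -/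

import Mathlib

open MeasureTheory ENNReal Set Filter
open scoped NNReal ENNReal

noncomputable section

/-- A right-continuous, time-homogeneous Markov process on `ℕ` with laws `P x`
(`P x (X 0 = x) = 1`), in which the state `0` is absorbing and absorption is
almost sure. The (time-homogeneous, countable-state) Markov property is stated
in terms of the shifted path. -/
structure AbsorbedProcess (Ω : Type*) [MeasurableSpace Ω] where
  P : ℕ → Measure Ω
  prob : ∀ x, IsProbabilityMeasure (P x)
  X : ℝ≥0 → Ω → ℕ
  meas : ∀ t, Measurable (X t)
  init : ∀ x, P x {ω | X 0 ω = x} = 1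
  rightCont : ∀ x, ∀ᵐ ω ∂ P x, ∀ t : ℝ≥0, ∃ ε : ℝ≥0, 0 < ε ∧
    ∀ s : ℝ≥0, t ≤ s → s < t + ε → X s ω = X t ω
  markov : ∀ (x y : ℕ) (s : ℝ≥0) (B : Set (ℝ≥0 → ℕ)), MeasurableSet B →
    P x ({ω | X s ω = y} ∩ {ω | (fun u => X (s + u) ω) ∈ B})
      = P x {ω | X s ω = y} * P y {ω | (fun u => X u ω) ∈ B}
  absorbing : ∀ x, ∀ᵐ ω ∂ P x, ∀ s t : ℝ≥0, s ≤ t → X s ω = 0 → X t ω = 0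
  absorbSure : ∀ x, P x {ω | ∃ t : ℝ≥0, X t ω = 0} = 1

variable {Ω : Type*} [MeasurableSpace Ω]

/-- The hitting time `T_K = inf {t ≥ 0 : X_t ∈ K}` (equal to `∞` if `K` is never hit). -/
def hitT (M : AbsorbedProcess Ω) (K : Set ℕ) (ω : Ω) : ℝ≥0∞ :=
  ⨅ t : {t : ℝ≥0 // M.X t ω ∈ K}, (t.1 : ℝ≥0∞)

/-- The survival event `{t < T_0}`. -/
def alive (M : AbsorbedProcess Ω) (t : ℝ≥0) : Set Ω := {ω | (t : ℝ≥0∞) < hitT M {0} ω}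

/-- `ℙ_μ = ∑_x μ({x}) ℙ_x`. -/
def Pmu (M : AbsorbedProcess Ω) (μ : Measure ℕ) : Measure Ω := μ.bind M.P

/-- The conditional distribution `ℙ_μ(X_t ∈ · | t < T_0)`, as a measure on `ℕ`. -/
def condDist (M : AbsorbedProcess Ω) (μ : Measure ℕ) (t : ℝ≥0) : Measure ℕ :=
  (Pmu M μ (alive M t))⁻¹ • ((Pmu M μ).restrict (alive M t)).map (M.X t)

/-- Total variation distance between two measures on `ℕ`:
`‖μ - ν‖_TV = ∑_x |μ({x}) - ν({x})|`. -/
def tvDist (μ ν : Measure ℕ) : ℝ := ∑' x : ℕ, |(μ {x}).toReal - (ν {x}).toReal|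

/-- `e^{l·t}` for an extended nonnegative time `t`. -/
def expE (l : ℝ) (t : ℝ≥0∞) : ℝ≥0∞ :=
  if t = ∞ then ∞ else ENNReal.ofReal (Real.exp (l * t.toReal))

/-- Hypothesis (H): there are `K ⊆ ℕ*`, `x₀ ∈ K` and positive constants
`c₁, c₂, c₃, c₄, λ₀` such that
(1) `ℙ_x(X_1 = x₀ | 1 < T_0) ≥ c₁` for all `x ∈ ℕ*`;
(2) `inf_{x ∈ K} ℙ_x(t < T_0) ≥ c₂ sup_{x ∈ K} ℙ_x(t < T_0)` for all `t ≥ 0`;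
(3) `ℙ_{x₀}(X_t ∈ K) ≥ c₃ e^{-λ₀ t}` for all `t ≥ 0`;
(4) `sup_{x ∈ ℕ*} 𝔼_x(e^{λ₀ (T_K ∧ T_0)}) ≤ c₄`. -/
def HypH (M : AbsorbedProcess Ω) (K : Set ℕ) (x0 : ℕ) (c1 c2 c3 c4 l0 : ℝ) : Prop :=
  0 ∉ K ∧ x0 ∈ K ∧ 0 < c1 ∧ 0 < c2 ∧ 0 < c3 ∧ 0 < c4 ∧ 0 < l0 ∧
  (∀ x : ℕ, x ≠ 0 → ENNReal.ofReal c1 * M.P x (alive M 1)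
      ≤ M.P x ({ω | M.X 1 ω = x0} ∩ alive M 1)) ∧
  (∀ t : ℝ≥0, ∀ x ∈ K, ∀ y ∈ K,
      ENNReal.ofReal c2 * M.P y (alive M t) ≤ M.P x (alive M t)) ∧
  (∀ t : ℝ≥0, ENNReal.ofReal (c3 * Real.exp (-(l0 * (t : ℝ)))) ≤ M.P x0 {ω | M.X t ω ∈ K}) ∧
  (∀ x : ℕ, x ≠ 0 →
      ∫⁻ ω, expE l0 (min (hitT M K ω) (hitT M {0} ω)) ∂ M.P x ≤ ENNReal.ofReal c4)

/-- The path of the process started afresh at time `s`. -/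
def shiftPath (M : AbsorbedProcess Ω) (s : ℝ≥0) (ω : Ω) : ℝ≥0 → ℕ := fun u => M.X (s + u) ω

/-- The survival probability `ℙ_x(X_t ≠ 0)`. -/
def surv (M : AbsorbedProcess Ω) (t : ℝ≥0) (x : ℕ) : ℝ≥0∞ := M.P x {ω | M.X t ω ≠ 0}

open Classical in
/-- `E ^ k`, where `k` is the first index at most `m` with `w (k h) ∈ L` (`k = m` if there is
none). -/
def gridWeight (L : Set ℕ) (h : ℝ≥0) (E : ℝ≥0∞) : ℕ → (ℝ≥0 → ℕ) → ℝ≥0∞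
  | 0, _ => 1
  | m + 1, w => if w 0 ∈ L then 1 else E * gridWeight L h E m (fun u => w (h + u))

lemma measurable_shiftPath (M : AbsorbedProcess Ω) (s : ℝ≥0) : Measurable (shiftPath M s) :=
  measurable_pi_lambda _ fun u => M.meas (s + u)

lemma shiftPath_zero (M : AbsorbedProcess Ω) : shiftPath M 0 = fun ω u => M.X u ω := by
  funext ω u
  simp [shiftPath]

lemma measurable_gridWeight (L : Set ℕ) (h : ℝ≥0) (E : ℝ≥0∞) (m : ℕ) :
    Measurable (gridWeight L h E m) := by
  induction m with
  | zero => exact measurable_const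
  | succ m ih =>
    refine Measurable.ite (measurable_pi_apply (X := fun _ : ℝ≥0 => ℕ) 0
      (MeasurableSet.of_discrete (s := L))) measurable_const (measurable_const.mul (ih.comp ?_))
    exact measurable_pi_lambda _ fun u => measurable_pi_apply (h + u)

lemma gridWeight_le_pow (L : Set ℕ) (h : ℝ≥0) {E : ℝ≥0∞} (hE : 1 ≤ E) (m : ℕ) (w : ℝ≥0 → ℕ) :
    gridWeight L h E m w ≤ E ^ m := by
  induction m generalizing w with
  | zero => simp [gridWeight]
  | succ m ih =>
    unfold gridWeight
    split_ifs
    · exact one_le_pow_of_one_le' hE _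
    · rw [pow_succ']
      gcongr
      exact ih _

lemma gridWeight_le_pow_of_mem (L : Set ℕ) (h : ℝ≥0) {E : ℝ≥0∞} (hE : 1 ≤ E) (m k : ℕ)
    (hkm : k ≤ m) (w : ℝ≥0 → ℕ) (hw : w (k * h) ∈ L) :
    gridWeight L h E m w ≤ E ^ k := by
  induction m generalizing w k with
  | zero => simpa [gridWeight] using one_le_pow_of_one_le' hE k
  | succ m ih =>
    unfold gridWeight
    split_ifs with h0
    · exact one_le_pow_of_one_le' hE _
    · cases k with
      | zero => simp at hw; exact absurd hw h0
      | succ k =>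
        rw [pow_succ']
        gcongr
        refine ih k (by omega) _ ?_
        convert hw using 2
        push_cast
        ring

/-- The Markov property in integrated form. -/
lemma lintegral_shiftPath (M : AbsorbedProcess Ω) (x : ℕ) (s : ℝ≥0) {F : (ℝ≥0 → ℕ) → ℝ≥0∞}
    (hF : Measurable F) :
    ∫⁻ ω, F (shiftPath M s ω) ∂M.P x
      = ∑' y, M.P x {ω | M.X s ω = y} * ∫⁻ ω, F (shiftPath M 0 ω) ∂M.P y := by
  have key : (M.P x).map (shiftPath M s)
      = Measure.sum fun y => M.P x {ω | M.X s ω = y} • (M.P y).map (shiftPath M 0) := by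
    ext B hB
    rw [Measure.map_apply (measurable_shiftPath M s) hB, Measure.sum_apply _ hB]
    have hdec : (shiftPath M s) ⁻¹' B
        = ⋃ y, ({ω | M.X s ω = y} ∩ {ω | (fun u => M.X (s + u) ω) ∈ B}) := by
      ext ω
      simp only [Set.mem_preimage, Set.mem_iUnion, Set.mem_inter_iff, Set.mem_ofPred_eq,
        exists_and_right, exists_eq', true_and]
      rfl
    rw [hdec, measure_iUnion]
    · refine tsum_congr fun y => ?_
      rw [M.markov x y s B hB, Measure.smul_apply, smul_eq_mul,
        Measure.map_apply (measurable_shiftPath M 0) hB, shiftPath_zero]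
      rfl
    · intro y z hyz
      refine Set.disjoint_left.mpr ?_
      rintro ω ⟨h1, -⟩ ⟨h2, -⟩
      exact hyz (h1.symm.trans h2)
    · intro y
      exact ((M.meas s) (measurableSet_singleton y)).inter (measurable_shiftPath M s hB)
  rw [← lintegral_map hF (measurable_shiftPath M s), key, lintegral_sum_measure]
  refine tsum_congr fun y => ?_
  rw [lintegral_smul_measure, lintegral_map hF (measurable_shiftPath M 0), smul_eq_mul]

lemma surv_add (M : AbsorbedProcess Ω) (x : ℕ) (s r : ℝ≥0) :
    surv M (s + r) x = ∑' y, M.P x {ω | M.X s ω = y} * surv M r y := by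
  have hms : MeasurableSet {w : ℝ≥0 → ℕ | w r ≠ 0} :=
    measurable_pi_apply (X := fun _ : ℝ≥0 => ℕ) r
      (MeasurableSet.of_discrete (s := {n : ℕ | n ≠ 0}))
  have hsurv (s : ℝ≥0) (z : ℕ) : surv M (s + r) z
      = ∫⁻ ω, {w : ℝ≥0 → ℕ | w r ≠ 0}.indicator 1 (shiftPath M s ω) ∂M.P z := by
    rw [← lintegral_map (measurable_one.indicator hms) (measurable_shiftPath M s),
      lintegral_indicator_one hms, Measure.map_apply (measurable_shiftPath M s) hms]
    rfl
  rw [hsurv, lintegral_shiftPath M x s (measurable_one.indicator hms)]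
  simp only [← hsurv, zero_add]

lemma ae_init (M : AbsorbedProcess Ω) (x : ℕ) : ∀ᵐ ω ∂M.P x, M.X 0 ω = x := by
  have := M.prob x
  exact (prob_compl_eq_zero_iff ((M.meas 0) (measurableSet_singleton x))).mpr (M.init x)

lemma surv_zero_start (M : AbsorbedProcess Ω) (t : ℝ≥0) : surv M t 0 = 0 := by
  have : ∀ᵐ ω ∂M.P 0, ¬ (M.X t ω ≠ 0) := by
    filter_upwards [ae_init M 0, M.absorbing 0] with ω h0 ha
    simpa using ha 0 t zero_le h0
  simpa [surv, ae_iff] using this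

lemma surv_zero_time (M : AbsorbedProcess Ω) {x : ℕ} (hx : x ≠ 0) : surv M 0 x = 1 := by
  have := M.prob x
  refine le_antisymm prob_le_one ?_
  rw [← M.init x]
  refine measure_mono fun ω (hω : M.X 0 ω = x) => ?_
  simpa [hω] using hx

/-- Right-continuous paths are in `L` on a right neighbourhood of the hitting time of `L`. -/
lemma mem_of_hitT_eq (M : AbsorbedProcess Ω) (L : Set ℕ) (ω : Ω)
    (hrc : ∀ t : ℝ≥0, ∃ ε : ℝ≥0, 0 < ε ∧ ∀ s : ℝ≥0, t ≤ s → s < t + ε → M.X s ω = M.X t ω)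
    (τ : ℝ≥0) (hτ : hitT M L ω = τ) :
    ∃ ε : ℝ≥0, 0 < ε ∧ ∀ s : ℝ≥0, τ ≤ s → s < τ + ε → M.X s ω ∈ L := by
  obtain ⟨ε, hε, hc⟩ := hrc τ
  refine ⟨ε, hε, fun s hs1 hs2 => ?_⟩
  have hlt : hitT M L ω < ((τ + ε : ℝ≥0) : ℝ≥0∞) := by
    rw [hτ]
    exact_mod_cast lt_add_of_pos_right τ hε
  obtain ⟨⟨u, hu⟩, hut⟩ := iInf_lt_iff.mp hlt
  have hτu : τ ≤ u := by
    have : hitT M L ω ≤ (u : ℝ≥0∞) := iInf_le _ (⟨u, hu⟩ : {t : ℝ≥0 // M.X t ω ∈ L})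
    rw [hτ] at this
    exact_mod_cast this
  rw [hc s hs1 hs2, ← hc u hτu (by exact_mod_cast hut)]
  exact hu

lemma measure_alive (M : AbsorbedProcess Ω) (t : ℝ≥0) (x : ℕ) :
    M.P x (alive M t) = surv M t x := by
  refine measure_congr ?_
  filter_upwards [M.rightCont x, M.absorbing x] with ω hrc ha
  refine propext (?_ : (t : ℝ≥0∞) < hitT M {0} ω ↔ M.X t ω ≠ 0)
  constructor
  · intro hlt h0
    exact absurd (iInf_le _ (⟨t, h0⟩ : {t : ℝ≥0 // M.X t ω ∈ ({0} : Set ℕ)})) (not_le.mpr hlt)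
  · intro h0
    by_contra hle
    rw [not_lt] at hle
    have hne : hitT M {0} ω ≠ ∞ := ne_top_of_le_ne_top coe_ne_top hle
    obtain ⟨ε, hε, hmem⟩ := mem_of_hitT_eq M {0} ω hrc _ (coe_toNNReal hne).symm
    refine h0 (ha _ t ?_ (hmem _ le_rfl (lt_add_of_pos_right _ hε)))
    simpa using toNNReal_mono coe_ne_top hle

lemma hitT_insert_zero (M : AbsorbedProcess Ω) (K : Set ℕ) (ω : Ω) :
    hitT M (insert 0 K) ω = min (hitT M K ω) (hitT M {0} ω) := by
  simp only [hitT, iInf_subtype, Set.mem_insert_iff, Set.mem_singleton_iff, iInf_or, iInf_inf_eq]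
  exact inf_comm _ _

/-- Comparison of the survival probability with the expected grid weight, by induction on the
number of grid steps. -/
lemma surv_le_gridWeight (M : AbsorbedProcess Ω) (K : Set ℕ) (h : ℝ≥0) (D E : ℝ≥0∞) (N : ℕ)
    (hone : 1 ≤ D * E ^ N)
    (hbd : ∀ m j : ℕ, m + j = N → ∀ y ∈ K, surv M (m * h) y ≤ D * E ^ j)
    (m j : ℕ) (hmj : m + j = N) (x : ℕ) :
    surv M (m * h) x
      ≤ D * E ^ j * ∫⁻ ω, gridWeight (insert 0 K) h E m (shiftPath M 0 ω) ∂M.P x := by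
  induction m generalizing j x with
  | zero =>
    have := M.prob x
    obtain rfl : j = N := by omega
    have hle : surv M 0 x ≤ D * E ^ j := (prob_le_one (μ := M.P x)).trans hone
    simpa [gridWeight] using hle
  | succ m ih =>
    have := M.prob x
    by_cases hx : x ∈ insert 0 K
    · have hint : ∫⁻ ω, gridWeight (insert 0 K) h E (m + 1) (shiftPath M 0 ω) ∂M.P x = 1 := by
        rw [lintegral_congr_ae (g := fun _ => 1)]
        · simp
        · filter_upwards [ae_init M x] with ω h0
          simp only [gridWeight, shiftPath, add_zero, h0, hx, if_true]
      rw [hint, mul_one]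
      rcases hx with rfl | hx
      · simp [surv_zero_start]
      · exact hbd _ j hmj x hx
    · have hint : ∫⁻ ω, gridWeight (insert 0 K) h E (m + 1) (shiftPath M 0 ω) ∂M.P x
          = E * ∫⁻ ω, gridWeight (insert 0 K) h E m (shiftPath M h ω) ∂M.P x := by
        have hmeas : Measurable fun ω => gridWeight (insert 0 K) h E m (shiftPath M h ω) :=
          (measurable_gridWeight _ _ _ _).comp (measurable_shiftPath M h)
        rw [← lintegral_const_mul _ hmeas]
        refine lintegral_congr_ae ?_
        filter_upwards [ae_init M x] with ω h0
        simp only [gridWeight, shiftPath, add_zero, h0, hx, if_false, zero_add]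
        rfl
      have htime : ((m + 1 : ℕ) : ℝ≥0) * h = h + m * h := by
        push_cast
        ring
      rw [hint, lintegral_shiftPath M x h (measurable_gridWeight _ _ _ _), htime, surv_add,
        ← mul_assoc, mul_assoc D, ← pow_succ, ← ENNReal.tsum_mul_left]
      refine ENNReal.tsum_le_tsum fun y => ?_
      rw [mul_left_comm]
      gcongr
      exact ih (j + 1) (by omega) y

/-- As the mesh tends to zero, the grid weights are asymptotically at most `e^{l T_L}`. -/
lemma limsup_gridWeight_le (M : AbsorbedProcess Ω) (L : Set ℕ) {l : ℝ} (hl : 0 < l) (t : ℝ≥0)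
    (ω : Ω)
    (hrc : ∀ t : ℝ≥0, ∃ ε : ℝ≥0, 0 < ε ∧ ∀ s : ℝ≥0, t ≤ s → s < t + ε → M.X s ω = M.X t ω) :
    limsup (fun n : ℕ => gridWeight L (t / (n + 1 : ℕ))
        (ENNReal.ofReal (Real.exp (l * (t / (n + 1 : ℕ) : ℝ≥0)))) (n + 1) (shiftPath M 0 ω)) atTop
      ≤ expE l (hitT M L ω) := by
  have hE (h : ℝ≥0) : 1 ≤ ENNReal.ofReal (Real.exp (l * h)) := by
    rw [ENNReal.one_le_ofReal]
    exact Real.one_le_exp (by positivity)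
  have hpow (h : ℝ≥0) (k : ℕ) : ENNReal.ofReal (Real.exp (l * h)) ^ k
      = ENNReal.ofReal (Real.exp (l * (k * h : ℝ≥0))) := by
    rw [← ENNReal.ofReal_pow (Real.exp_nonneg _), ← Real.exp_nat_mul]
    congr 2
    push_cast
    ring
  rcases le_or_gt (t : ℝ≥0∞) (hitT M L ω) with hle | hlt
  · refine limsup_le_of_le (by isBoundedDefault) (Eventually.of_forall fun n => ?_)
    refine (gridWeight_le_pow L _ (hE _) _ _).trans ?_
    rw [hpow, mul_div_cancel₀ _ (by positivity), expE]
    split_ifs with htop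
    · exact le_top
    · gcongr
      simpa using ENNReal.toReal_mono htop hle
  · have hne : hitT M L ω ≠ ∞ := ne_top_of_lt hlt
    obtain ⟨τ, hτ⟩ : ∃ τ : ℝ≥0, hitT M L ω = τ := ⟨_, (coe_toNNReal hne).symm⟩
    have hτt : τ < t := by
      rw [hτ] at hlt
      exact_mod_cast hlt
    have ht : 0 < t := pos_of_gt hτt
    obtain ⟨ε, hε, hmem⟩ := mem_of_hitT_eq M L ω hrc τ hτ
    have hmesh : Tendsto (fun n : ℕ => t / ((n + 1 : ℕ) : ℝ≥0)) atTop (nhds 0) :=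
      (tendsto_const_div_atTop_nhds_zero_nat t).comp (tendsto_add_atTop_nat 1)
    have hlim : Tendsto (fun n : ℕ => ENNReal.ofReal
        (Real.exp (l * (τ + t / ((n + 1 : ℕ) : ℝ≥0) : ℝ≥0)))) atTop
        (nhds (expE l (hitT M L ω))) := by
      have hval : expE l (hitT M L ω) = ENNReal.ofReal (Real.exp (l * (τ + 0 : ℝ≥0))) := by
        simp [expE, hτ]
      rw [hval]
      have hcont : Continuous fun h : ℝ≥0 => ENNReal.ofReal (Real.exp (l * (τ + h : ℝ≥0))) :=
        ENNReal.continuous_ofReal.comp (by fun_prop)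
      exact (hcont.tendsto 0).comp hmesh
    rw [← hlim.limsup_eq]
    refine limsup_le_limsup ?_
    filter_upwards [hmesh.eventually_lt_const hε] with n hn
    set h : ℝ≥0 := t / ((n + 1 : ℕ) : ℝ≥0) with hh
    have hpos : 0 < h := by positivity
    have hk1 : τ ≤ ⌈τ / h⌉₊ * h := (div_le_iff₀ hpos).mp (Nat.le_ceil _)
    have hk2 : ⌈τ / h⌉₊ * h < τ + h := by
      have := mul_lt_mul_of_pos_right (Nat.ceil_lt_add_one (zero_le (a := τ / h))) hpos
      rwa [add_mul, one_mul, div_mul_cancel₀ _ hpos.ne'] at this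
    have hk3 : ⌈τ / h⌉₊ ≤ n + 1 := by
      refine Nat.ceil_le.mpr ((div_le_iff₀ hpos).mpr ?_)
      rw [hh, mul_div_cancel₀ _ (by positivity)]
      exact hτt.le
    refine (gridWeight_le_pow_of_mem L h (hE _) _ _ hk3 _ ?_).trans ?_
    · rw [shiftPath_zero]
      exact hmem _ hk1 (hk2.trans (by gcongr))
    · rw [hpow]
      gcongr

/-- Survival from `K` over a shorter time is controlled by survival from `x0`. -/
lemma surv_le_of_mem (M : AbsorbedProcess Ω) (K : Set ℕ) (x0 : ℕ) {c2 c3 l0 : ℝ}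
    (hc2 : 0 < c2) (hc3 : 0 < c3)
    (h2 : ∀ t : ℝ≥0, ∀ x ∈ K, ∀ y ∈ K, ENNReal.ofReal c2 * surv M t y ≤ surv M t x)
    (h3 : ∀ t : ℝ≥0,
      ENNReal.ofReal (c3 * Real.exp (-(l0 * (t : ℝ)))) ≤ M.P x0 {ω | M.X t ω ∈ K})
    (s r : ℝ≥0) (y : ℕ) (hy : y ∈ K) :
    surv M r y ≤ ENNReal.ofReal (1 / (c2 * c3)) * surv M (s + r) x0
      * ENNReal.ofReal (Real.exp (l0 * s)) := by
  have hK : M.P x0 {ω | M.X s ω ∈ K} = ∑' z, K.indicator (fun z => M.P x0 {ω | M.X s ω = z}) z := by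
    have hmap := Measure.map_apply (μ := M.P x0) (M.meas s) (MeasurableSet.of_discrete (s := K))
    change M.P x0 (M.X s ⁻¹' K) = _
    rw [← hmap, ← Measure.tsum_indicator_apply_singleton _ K MeasurableSet.of_discrete]
    refine tsum_congr fun z => ?_
    congr 1
    funext z
    exact Measure.map_apply (M.meas s) (measurableSet_singleton z)
  have hlow : ENNReal.ofReal (c3 * Real.exp (-(l0 * (s : ℝ)))) * (ENNReal.ofReal c2 * surv M r y)
      ≤ surv M (s + r) x0 := by
    rw [surv_add]
    refine (mul_le_mul_left (h3 s) _).trans ?_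
    rw [hK, ← ENNReal.tsum_mul_right]
    refine ENNReal.tsum_le_tsum fun z => ?_
    by_cases hz : z ∈ K
    · rw [Set.indicator_of_mem hz]
      gcongr
      exact h2 r z hz y hy
    · simp [Set.indicator_of_notMem hz]
  calc surv M r y
      = ENNReal.ofReal (1 / (c2 * c3)) * (ENNReal.ofReal (c3 * Real.exp (-(l0 * (s : ℝ))))
          * (ENNReal.ofReal c2 * surv M r y)) * ENNReal.ofReal (Real.exp (l0 * s)) := by
        have hcancel : ENNReal.ofReal (1 / (c2 * c3))
            * ENNReal.ofReal (c3 * Real.exp (-(l0 * (s : ℝ)))) * ENNReal.ofReal c2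
            * ENNReal.ofReal (Real.exp (l0 * s)) = 1 := by
          rw [← ENNReal.ofReal_mul (by positivity), ← ENNReal.ofReal_mul (by positivity),
            ← ENNReal.ofReal_mul (by positivity), Real.exp_neg, ← ENNReal.ofReal_one]
          congr 1
          field_simp
        calc surv M r y = 1 * surv M r y := (one_mul _).symm
          _ = _ := by
            rw [← hcancel]
            ring
    _ ≤ _ := by gcongr

/-- assume parts (2), (3) and (4) of Hypothesis (H) (and `c₂ ≤ 1`,
which is automatic from part (2)). Then for all `t ≥ 0`,
`ℙ_{x₀}(t < T_0) ≥ (c₂c₃/(2c₄)) · sup_{x ∈ ℕ*} ℙ_x(t < T_0)`. -/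
theorem survival_comparison (M : AbsorbedProcess Ω) (K : Set ℕ) (x0 : ℕ)
    (c2 c3 c4 l0 : ℝ)
    (hK0 : 0 ∉ K) (hx0K : x0 ∈ K)
    (hc2 : 0 < c2) (hc2' : c2 ≤ 1) (hc3 : 0 < c3) (hc4 : 0 < c4) (hl0 : 0 < l0)
    (h2 : ∀ t : ℝ≥0, ∀ x ∈ K, ∀ y ∈ K,
        ENNReal.ofReal c2 * M.P y (alive M t) ≤ M.P x (alive M t))
    (h3 : ∀ t : ℝ≥0,
        ENNReal.ofReal (c3 * Real.exp (-(l0 * (t : ℝ)))) ≤ M.P x0 {ω | M.X t ω ∈ K})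
    (h4 : ∀ x : ℕ, x ≠ 0 →
        ∫⁻ ω, expE l0 (min (hitT M K ω) (hitT M {0} ω)) ∂ M.P x ≤ ENNReal.ofReal c4) :
    ∀ t : ℝ≥0, ∀ x : ℕ, x ≠ 0 →
      ENNReal.ofReal (c2 * c3 / (2 * c4)) * M.P x (alive M t) ≤ M.P x0 (alive M t) := by
  intro t x hx
  simp only [measure_alive] at h2 ⊢
  simp only [← hitT_insert_zero] at h4
  set D : ℝ≥0∞ := ENNReal.ofReal (1 / (c2 * c3)) * surv M t x0 with hD
  have hstart : 1 ≤ D * ENNReal.ofReal (Real.exp (l0 * t)) := by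
    have := surv_le_of_mem M K x0 hc2 hc3 h2 h3 t 0 x0 hx0K
    rwa [surv_zero_time M (ne_of_mem_of_not_mem hx0K hK0), add_zero] at this
  have hpow (h : ℝ≥0) (k : ℕ) : ENNReal.ofReal (Real.exp (l0 * h)) ^ k
      = ENNReal.ofReal (Real.exp (l0 * (k * h : ℝ≥0))) := by
    rw [← ENNReal.ofReal_pow (Real.exp_nonneg _), ← Real.exp_nat_mul]
    congr 2
    push_cast
    ring
  let g : ℕ → Ω → ℝ≥0∞ := fun n ω => gridWeight (insert 0 K) (t / (n + 1 : ℕ))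
    (ENNReal.ofReal (Real.exp (l0 * (t / (n + 1 : ℕ) : ℝ≥0)))) (n + 1) (shiftPath M 0 ω)
  have hgrid (n : ℕ) : surv M t x ≤ D * ∫⁻ ω, g n ω ∂M.P x := by
    have htime : ((n + 1 : ℕ) : ℝ≥0) * (t / (n + 1 : ℕ)) = t := mul_div_cancel₀ _ (by positivity)
    have := surv_le_gridWeight M K (t / (n + 1 : ℕ)) D
      (ENNReal.ofReal (Real.exp (l0 * (t / (n + 1 : ℕ) : ℝ≥0)))) (n + 1)
      (by rw [hpow, htime]; exact hstart)
      (fun m j hmj y hy => by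
        rw [hpow, hD]
        convert surv_le_of_mem M K x0 hc2 hc3 h2 h3 (j * (t / (n + 1 : ℕ)))
          (m * (t / (n + 1 : ℕ))) y hy using 4
        rw [← add_mul, ← Nat.cast_add, add_comm j, hmj, htime])
      (n + 1) 0 rfl x
    rwa [htime, pow_zero, mul_one] at this
  have := M.prob x
  have hlimsup : limsup (fun n => ∫⁻ ω, g n ω ∂M.P x) atTop ≤ ENNReal.ofReal c4 := by
    refine (limsup_lintegral_le (fun _ => ENNReal.ofReal (Real.exp (l0 * t))) ?_ ?_ ?_).trans
      ((lintegral_mono_ae ?_).trans (h4 x hx))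
    · exact fun n => (measurable_gridWeight _ _ _ _).comp (measurable_shiftPath M 0)
    · refine fun n => Eventually.of_forall fun ω => ?_
      refine (gridWeight_le_pow _ _ ?_ _ _).trans ?_
      · rw [ENNReal.one_le_ofReal]
        exact Real.one_le_exp (by positivity)
      · rw [hpow, mul_div_cancel₀ _ (by positivity)]
    · simp
    · filter_upwards [M.rightCont x] with ω hrc
      exact limsup_gridWeight_le M _ hl0 t ω hrc
  have hDtop : D ≠ ∞ := by
    have := M.prob x0
    exact ENNReal.mul_ne_top ENNReal.ofReal_ne_top (measure_ne_top _ _)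
  have hmain : surv M t x ≤ D * ENNReal.ofReal c4 := by
    refine le_trans ?_ (mul_le_mul_right hlimsup D)
    rw [← ENNReal.limsup_const_mul_of_ne_top hDtop]
    exact le_limsup_of_frequently_le (Eventually.of_forall hgrid).frequently
  calc ENNReal.ofReal (c2 * c3 / (2 * c4)) * surv M t x
      ≤ ENNReal.ofReal (c2 * c3 / (2 * c4)) * (D * ENNReal.ofReal c4) := by gcongr
    _ = ENNReal.ofReal (1 / 2) * surv M t x0 := by
        have hconst : ENNReal.ofReal (c2 * c3 / (2 * c4)) * ENNReal.ofReal (1 / (c2 * c3))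
            * ENNReal.ofReal c4 = ENNReal.ofReal (1 / 2) := by
          rw [← ENNReal.ofReal_mul (by positivity), ← ENNReal.ofReal_mul (by positivity)]
          congr 1
          field_simp
        rw [← hconst, hD]
        ring
    _ ≤ surv M t x0 := mul_le_of_le_one_left zero_le
        (ENNReal.ofReal_le_one.mpr (by norm_num))

end
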